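/- Let Sol = {f ∈ ℝ[x₁,x₂,x₃] : e₂(∂)f = e₆(∂)f = e₄(∂)²f = 0} and H = {f ∈ ℝ[x₁,x₂,x₃] : e₂(∂)f = e₄(∂)f = e₆(∂)f = 0}. Then H ⊆ Sol, the linear map f ↦ e₄(∂)f maps Sol onto H (it is surjective from Sol to H), and its kernel in Sol is exactly H; that is, the sequence 0 → H → Sol → H → 0 given by inclusion and e₄(∂) is exact. -/

import Mathlib

open MvPolynomial

noncomputable def dop (φ : MvPolynomial (Fin 3) ℝ) :
    MvPolynomial (Fin 3) ℝ →ₗ[ℝ] MvPolynomial (Fin 3) ℝ :=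
  φ.support.sum fun s => φ.coeff s •
    (((pderiv (0 : Fin 3)).toLinearMap ^ s 0) *
     ((pderiv (1 : Fin 3)).toLinearMap ^ s 1) *
     ((pderiv (2 : Fin 3)).toLinearMap ^ s 2))

noncomputable def e2 : MvPolynomial (Fin 3) ℝ := X 0 ^ 2 + X 1 ^ 2 + X 2 ^ 2
noncomputable def e4 : MvPolynomial (Fin 3) ℝ :=
  X 1 ^ 2 * X 2 ^ 2 + X 2 ^ 2 * X 0 ^ 2 + X 0 ^ 2 * X 1 ^ 2
noncomputable def e6 : MvPolynomial (Fin 3) ℝ := X 0 ^ 2 * X 1 ^ 2 * X 2 ^ 2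

/-- The solution space of the system `e₂(∂)f = e₆(∂)f = e₄(∂)²f = 0`. -/
def Sol : Set (MvPolynomial (Fin 3) ℝ) :=
  {f | dop e2 f = 0 ∧ dop e6 f = 0 ∧ dop e4 (dop e4 f) = 0}

/-- The space of `W(B₃)`-harmonic polynomials. -/
def H : Set (MvPolynomial (Fin 3) ℝ) :=
  {f | dop e2 f = 0 ∧ dop e4 f = 0 ∧ dop e6 f = 0}

/-- `e4` is a nonzerodivisor modulo the ideal `(e2, p)`. -/
def E4RegularMod (p : MvPolynomial (Fin 3) ℝ) : Prop :=
  ∀ a b c, e4 * a + e2 * b + p * c = 0 → ∃ u v, a = e2 * u + p * v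

lemma X_dvd_sub_aeval {σ R : Type*} [DecidableEq σ] [CommRing R] (i : σ) (p : MvPolynomial σ R) :
    X i ∣ p - aeval (fun l => if l = i then (0 : MvPolynomial σ R) else X l) p := by
  rw [← Ideal.mem_span_singleton, ← Ideal.Quotient.mk_eq_mk_iff_sub_mem]
  have h : Ideal.Quotient.mkₐ R (Ideal.span {(X i : MvPolynomial σ R)}) =
      (Ideal.Quotient.mkₐ R (Ideal.span {(X i : MvPolynomial σ R)})).comp
        (aeval fun l => if l = i then (0 : MvPolynomial σ R) else X l) := by
    refine algHom_ext fun l => ?_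
    by_cases hl : l = i
    · subst hl
      simp
    · simp [hl]
  exact DFunLike.congr_fun h p

lemma not_X_dvd_sq_add_sq {σ : Type*} {j k : σ} (hjk : j ≠ k) :
    ¬ (X j : MvPolynomial σ ℝ) ∣ X j ^ 2 + X k ^ 2 := by
  intro h
  rw [dvd_add_right (dvd_pow_self _ two_ne_zero)] at h
  exact hjk (X_dvd_X.1 ((X_prime (i := j)).dvd_of_dvd_pow h))

lemma exists_eq_of_sq_relation {σ : Type*} [DecidableEq σ] {i j k : σ} (hij : j ≠ i) (hik : k ≠ i)
    (hjk : j ≠ k) (a b c : MvPolynomial σ ℝ)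
    (h : (X j ^ 2 * X k ^ 2 + X i ^ 2 * (X j ^ 2 + X k ^ 2)) * a
      + (X i ^ 2 + (X j ^ 2 + X k ^ 2)) * b + X i * c = 0) :
    ∃ u v, a = (X i ^ 2 + (X j ^ 2 + X k ^ 2)) * u + X i * v := by
  have hσ := congrArg (aeval fun l => if l = i then (0 : MvPolynomial σ ℝ) else X l) h
  obtain ⟨r, hr⟩ := X_dvd_sub_aeval i a
  simp only [map_add, map_mul, map_pow, aeval_X, if_neg hij, if_neg hik, if_true, map_zero] at hσ
  generalize (aeval fun l => if l = i then (0 : MvPolynomial σ ℝ) else X l) a = a' at *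
  generalize (aeval fun l => if l = i then (0 : MvPolynomial σ ℝ) else X l) b = b' at *
  obtain ⟨b₁, rfl⟩ : X j ^ 2 ∣ b' :=
    (X_prime (i := j)).pow_dvd_of_dvd_mul_left 2 (not_X_dvd_sq_add_sq hjk)
      ⟨-(X k ^ 2 * a'), by linear_combination hσ⟩
  have h₁ : X k ^ 2 * a' + (X j ^ 2 + X k ^ 2) * b₁ = 0 := by
    refine mul_left_cancel₀ (pow_ne_zero 2 (X_ne_zero (R := ℝ) j)) ?_
    linear_combination hσ
  obtain ⟨d, rfl⟩ : X k ^ 2 ∣ b₁ :=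
    (X_prime (i := k)).pow_dvd_of_dvd_mul_left 2 (not_X_dvd_sq_add_sq hjk.symm)
      ⟨-a', by linear_combination h₁⟩
  have h₂ : a' + (X j ^ 2 + X k ^ 2) * d = 0 := by
    refine mul_left_cancel₀ (pow_ne_zero 2 (X_ne_zero (R := ℝ) k)) ?_
    linear_combination h₁
  exact ⟨-d, r + X i * d, by linear_combination hr + h₂⟩

lemma exists_e2_eq_and_e4_eq (i : Fin 3) : ∃ j k : Fin 3, j ≠ i ∧ k ≠ i ∧ j ≠ k ∧
    e2 = X i ^ 2 + (X j ^ 2 + X k ^ 2) ∧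
    e4 = X j ^ 2 * X k ^ 2 + X i ^ 2 * (X j ^ 2 + X k ^ 2) := by
  unfold e2 e4
  obtain rfl | rfl | rfl : i = 0 ∨ i = 1 ∨ i = 2 := by fin_cases i <;> simp
  · exact ⟨1, 2, by decide, by decide, by decide, by ring, by ring⟩
  · exact ⟨2, 0, by decide, by decide, by decide, by ring, by ring⟩
  · exact ⟨0, 1, by decide, by decide, by decide, by ring, by ring⟩

lemma e4RegularMod_X (i : Fin 3) : E4RegularMod (X i) := by
  obtain ⟨j, k, hj, hk, hjk, h2, h4⟩ := exists_e2_eq_and_e4_eq i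
  intro a b c h
  rw [h2, h4] at *
  exact exists_eq_of_sq_relation hj hk hjk a b c h

lemma not_X_dvd_e2 (i : Fin 3) : ¬ X i ∣ e2 := by
  obtain ⟨j, k, hj, hk, hjk, h2, -⟩ := exists_e2_eq_and_e4_eq i
  intro h
  rw [h2, dvd_add_right (dvd_pow_self _ two_ne_zero)] at h
  have h' := map_dvd (aeval fun l => if l = i then (0 : MvPolynomial (Fin 3) ℝ) else X l) h
  simp only [map_add, map_pow, aeval_X, if_neg hj, if_neg hk, if_true, zero_dvd_iff] at h'
  exact not_X_dvd_sq_add_sq hjk (h' ▸ dvd_zero _)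

lemma E4RegularMod.X_mul {q : MvPolynomial (Fin 3) ℝ} (hq : E4RegularMod q) (i : Fin 3) :
    E4RegularMod (X i * q) := by
  intro a b c h
  obtain ⟨u, v, rfl⟩ := e4RegularMod_X i a b (q * c) (by linear_combination h)
  obtain ⟨w, hw⟩ : X i ∣ e4 * u + b :=
    ((X_prime (i := i)).dvd_or_dvd (a := e2)
      ⟨-(e4 * v + q * c), by linear_combination h⟩).resolve_left (not_X_dvd_e2 i)
  obtain ⟨u', v', rfl⟩ := hq v w c <| by
    refine mul_left_cancel₀ (X_ne_zero (R := ℝ) i) ?_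
    linear_combination h - e2 * hw
  exact ⟨u + X i * u', v', by ring⟩

lemma e4RegularMod_e6 : E4RegularMod e6 := by
  have h := ((((((e4RegularMod_X 2).X_mul 2).X_mul 1).X_mul 1).X_mul 0).X_mul 0)
  convert h using 1
  unfold e6
  ring

/-- The factorial pairing `⟨f, p⟩ = (p(∂) f)(0)`. -/
noncomputable def factorialPairing :
    MvPolynomial (Fin 3) ℝ →ₗ[ℝ] MvPolynomial (Fin 3) ℝ →ₗ[ℝ] ℝ :=
  ((basisMonomials (Fin 3) ℝ).constr ℝ).toLinearMap ∘ₗ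
    LinearMap.pi fun s => (∏ i, ((s i).factorial : ℝ)) • lcoeff ℝ s

lemma factorialPairing_monomial (f : MvPolynomial (Fin 3) ℝ) (s : Fin 3 →₀ ℕ) (c : ℝ) :
    factorialPairing f (monomial s c) = c * ((∏ i, ((s i).factorial : ℝ)) * coeff s f) := by
  have h : (monomial s c : MvPolynomial (Fin 3) ℝ) = c • basisMonomials (Fin 3) ℝ s := by
    simp [smul_monomial]
  rw [h, map_smul, factorialPairing, LinearMap.comp_apply, LinearEquiv.coe_coe,
    Module.Basis.constr_basis]
  simp

lemma prod_factorial_ne_zero (s : Fin 3 →₀ ℕ) : ∏ i, ((s i).factorial : ℝ) ≠ 0 :=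
  Finset.prod_ne_zero_iff.2 fun i _ => by positivity

lemma factorialPairing_injective : Function.Injective factorialPairing := by
  intro f g h
  ext s
  have hs := DFunLike.congr_fun h (monomial s 1)
  simp only [factorialPairing_monomial, one_mul] at hs
  exact mul_left_cancel₀ (prod_factorial_ne_zero s) hs

lemma factorialPairing_pderiv (i : Fin 3) (f p : MvPolynomial (Fin 3) ℝ) :
    factorialPairing (pderiv i f) p = factorialPairing f (X i * p) := by
  suffices h : factorialPairing (pderiv i f) =
      factorialPairing f ∘ₗ LinearMap.mulLeft ℝ (X i) from DFunLike.congr_fun h p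
  refine (basisMonomials (Fin 3) ℝ).ext fun s => ?_
  simp only [coe_basisMonomials, LinearMap.comp_apply, LinearMap.mulLeft_apply, X, monomial_mul,
    factorialPairing_monomial, coeff_pderiv]
  have h : ∏ l, (((Finsupp.single i 1 + s : Fin 3 →₀ ℕ) l).factorial : ℝ) =
      (s i + 1) * ∏ l, ((s l).factorial : ℝ) := by
    rw [← Finset.mul_prod_erase _ _ (Finset.mem_univ i),
      ← Finset.mul_prod_erase _ (fun l => ((s l).factorial : ℝ)) (Finset.mem_univ i), ← mul_assoc]
    congr 1
    · simp [add_comm 1, Nat.factorial_succ]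
    · refine Finset.prod_congr rfl fun l hl => ?_
      simp [(Finset.ne_of_mem_erase hl).symm]
  rw [h, add_comm s]
  ring

lemma factorialPairing_pderiv_pow (i : Fin 3) (n : ℕ) (f p : MvPolynomial (Fin 3) ℝ) :
    factorialPairing (((pderiv i).toLinearMap ^ n) f) p = factorialPairing f (X i ^ n * p) := by
  induction n generalizing f with
  | zero => simp
  | succ n ih =>
    rw [pow_succ, Module.End.mul_apply, ih, Derivation.coeFn_coe, factorialPairing_pderiv, pow_succ']
    ring_nf

lemma factorialPairing_dop (φ f p : MvPolynomial (Fin 3) ℝ) :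
    factorialPairing (dop φ f) p = factorialPairing f (φ * p) := by
  conv_rhs => rw [φ.as_sum]
  rw [dop, LinearMap.sum_apply, map_sum, LinearMap.sum_apply, Finset.sum_mul, map_sum]
  refine Finset.sum_congr rfl fun s _ => ?_
  simp only [LinearMap.smul_apply, map_smul, Module.End.mul_apply, factorialPairing_pderiv_pow]
  rw [← map_smul, monomial_eq, Finsupp.prod_fintype _ _ fun _ => pow_zero _, Fin.prod_univ_three,
    smul_eq_C_mul]
  ring_nf

lemma dop_eq_zero_iff (φ f : MvPolynomial (Fin 3) ℝ) :
    dop φ f = 0 ↔ ∀ p, factorialPairing f (φ * p) = 0 := by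
  rw [← map_eq_zero_iff _ factorialPairing_injective, LinearMap.ext_iff]
  simp [factorialPairing_dop]

lemma dop_dop_comm (φ ψ f : MvPolynomial (Fin 3) ℝ) : dop φ (dop ψ f) = dop ψ (dop φ f) := by
  refine factorialPairing_injective (LinearMap.ext fun p => ?_)
  simp only [factorialPairing_dop, mul_left_comm]

lemma X_pow_six (i : Fin 3) : (X i : MvPolynomial (Fin 3) ℝ) ^ 6 =
    e2 * X i ^ 4 - e4 * X i ^ 2 + e6 := by
  unfold e2 e4 e6
  fin_cases i <;> simp only [Fin.zero_eta, Fin.mk_one, Fin.reduceFinMk] <;> ring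

/-- A functional vanishing on monomials of large degree is given by a polynomial. -/
lemma exists_factorialPairing_eq (Λ : MvPolynomial (Fin 3) ℝ →ₗ[ℝ] ℝ) (n : ℕ)
    (h : ∀ i p, Λ (X i ^ n * p) = 0) : ∃ f, factorialPairing f = Λ := by
  classical
  let S : Finset (Fin 3 →₀ ℕ) := Finset.Icc 0 (Finsupp.equivFunOnFinite.symm fun _ => n)
  refine ⟨∑ s ∈ S, monomial s (Λ (monomial s 1) / ∏ i, ((s i).factorial : ℝ)),
    (basisMonomials (Fin 3) ℝ).ext fun s => ?_⟩
  rw [coe_basisMonomials, factorialPairing_monomial, one_mul, coeff_sum]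
  simp only [coeff_monomial, Finset.sum_ite_eq']
  split_ifs with hs
  · exact mul_div_cancel₀ _ (prod_factorial_ne_zero s)
  · obtain ⟨i, hi⟩ : ∃ i, n < s i := by
      by_contra! hle
      exact hs (Finset.mem_Icc.2 ⟨fun _ => Nat.zero_le _, fun i => by simpa using hle i⟩)
    rw [mul_zero]
    have hd : (X i : MvPolynomial (Fin 3) ℝ) ^ n ∣ monomial s 1 := by
      rw [X_pow_eq_monomial, monomial_dvd_monomial]
      simp [hi.le]
    obtain ⟨q, hq⟩ := hd
    rw [hq, h]

lemma exists_linearMap_comp_eq {K V W U : Type*} [Field K] [AddCommGroup V] [Module K V]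
    [AddCommGroup W] [Module K W] [AddCommGroup U] [Module K U] (T : V →ₗ[K] W) (M : V →ₗ[K] U)
    (h : LinearMap.ker T ≤ LinearMap.ker M) : ∃ Λ : W →ₗ[K] U, Λ ∘ₗ T = M := by
  obtain ⟨Λ, hΛ⟩ := LinearMap.exists_extend
    ((LinearMap.ker T).liftQ M h ∘ₗ T.quotKerEquivRange.symm.toLinearMap)
  refine ⟨Λ, LinearMap.ext fun v => ?_⟩
  have hv := DFunLike.congr_fun hΛ (T.rangeRestrict v)
  have hq : T.quotKerEquivRange.symm (T.rangeRestrict v) = (LinearMap.ker T).mkQ v :=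
    T.quotKerEquivRange.symm_apply_eq.2 rfl
  simpa [hq] using hv

lemma exists_mem_Sol_dop_e4_eq {g : MvPolynomial (Fin 3) ℝ} (hg : g ∈ H) :
    ∃ f ∈ Sol, dop e4 f = g := by
  obtain ⟨h2, h4, h6⟩ := hg
  rw [dop_eq_zero_iff] at h2 h4 h6
  let T : (MvPolynomial (Fin 3) ℝ × MvPolynomial (Fin 3) ℝ) × MvPolynomial (Fin 3) ℝ →ₗ[ℝ]
      MvPolynomial (Fin 3) ℝ :=
    ((LinearMap.mulLeft ℝ e4).coprod (LinearMap.mulLeft ℝ e2)).coprod (LinearMap.mulLeft ℝ e6)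
  obtain ⟨Λ, hΛ⟩ := exists_linearMap_comp_eq T
    (factorialPairing g ∘ₗ LinearMap.fst ℝ _ _ ∘ₗ LinearMap.fst ℝ _ _) <| by
      rintro ⟨⟨a, b⟩, c⟩ habc
      obtain ⟨u, v, rfl⟩ := e4RegularMod_e6 a b c (by simpa [T] using habc)
      simp [h2, h6]
  have hΛ4 (a) : Λ (e4 * a) = factorialPairing g a := by
    simpa [T] using DFunLike.congr_fun hΛ ((a, 0), 0)
  have hΛ2 (b) : Λ (e2 * b) = 0 := by
    simpa [T] using DFunLike.congr_fun hΛ ((0, b), 0)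
  have hΛ6 (c) : Λ (e6 * c) = 0 := by
    simpa [T] using DFunLike.congr_fun hΛ ((0, 0), c)
  have hg6 (i p) : factorialPairing g (X i ^ 6 * p) = 0 := by
    rw [X_pow_six, add_mul, sub_mul, mul_assoc, mul_assoc]
    simp [h2, h4, h6]
  obtain ⟨f, rfl⟩ := exists_factorialPairing_eq Λ 12 fun i p => by
    have e : X i ^ 12 * p = e2 * (X i ^ 10 * p) - e4 * (X i ^ 6 * (X i ^ 2 * p)) +
        e6 * (X i ^ 6 * p) := by
      linear_combination X i ^ 6 * p * X_pow_six i
    rw [e, map_add, map_sub, hΛ2, hΛ4, hΛ6, hg6]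
    simp
  have hf : dop e4 f = g :=
    factorialPairing_injective (LinearMap.ext fun p => by rw [factorialPairing_dop, hΛ4])
  exact ⟨f, ⟨(dop_eq_zero_iff _ _).2 hΛ2, (dop_eq_zero_iff _ _).2 hΛ6,
    by rw [hf, dop_eq_zero_iff]; exact h4⟩, hf⟩

theorem exact_sequence_H_Sol_H :
    H ⊆ Sol ∧
    (∀ f ∈ Sol, dop e4 f ∈ H) ∧
    (∀ g ∈ H, ∃ f ∈ Sol, dop e4 f = g) ∧
    (∀ f ∈ Sol, (dop e4 f = 0 ↔ f ∈ H)) := by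
  refine ⟨fun f hf => ⟨hf.1, hf.2.2, by rw [hf.2.1, map_zero]⟩, fun f hf => ⟨?_, hf.2.2, ?_⟩,
    fun g hg => exists_mem_Sol_dop_e4_eq hg, fun f hf => ⟨fun h => ⟨hf.1, h, hf.2.1⟩, fun h => h.2.1⟩⟩
  · rw [dop_dop_comm, hf.1, map_zero]
  · rw [dop_dop_comm, hf.2.1, map_zero]
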